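/- arXiv:math/0010271 — 7 statements merged into one kernel-verified Lean document; each statement's English description precedes it below -/
import Mathlib

section
/- If C is a compact convex subset of ℝⁿ and F is a nonempty convex face of C, then there is a unique minimal exposed face F_e of C containing F: there exists a set F_e ⊆ C with IsExposed ℝ C F_e and F ⊆ F_e, such that every exposed face G of C with F ⊆ G satisfies F_e ⊆ G. -/
/-- In finite dimensions, a nonempty subset of `C` has a smallest exposed face of `C` above it.
It is cut out by the sum of finitely many functionals spanning the functionals on `E` which attain
their maximum over `C` at every point of `F`. -/
theorem exists_least_isExposed_superset {E : Type*} [NormedAddCommGroup E] [NormedSpace ℝ E]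
    [FiniteDimensional ℝ E] {C F : Set E} (hFC : F ⊆ C) (hFne : F.Nonempty) :
    ∃ Fe : Set E, IsExposed ℝ C Fe ∧ F ⊆ Fe ∧
      ∀ G : Set E, IsExposed ℝ C G → F ⊆ G → Fe ⊆ G := by
  let K : Set (StrongDual ℝ E) := {l | F ⊆ l.toExposed C}
  obtain ⟨s, hsK, hs⟩ := (Submodule.fg_span_iff_fg_span_finset_subset K).1
    (IsNoetherian.noetherian (Submodule.span ℝ K))
  refine ⟨(∑ l ∈ s, l).toExposed C, ContinuousLinearMap.toExposed.isExposed, ?_, ?_⟩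
  · refine fun f hf => ⟨hFC hf, fun y hy => ?_⟩
    simp only [sum_apply]
    exact Finset.sum_le_sum fun l hl => (hsK hl hf).2 y hy
  · rintro G hG hFG x ⟨hxC, hx⟩
    obtain ⟨f, hf⟩ := hFne
    obtain ⟨m, rfl⟩ := hG ⟨f, hFG hf⟩
    have hle : ∀ l ∈ s, l x ≤ l f := fun l hl => (hsK hl hf).2 x hxC
    have hsum : ∑ l ∈ s, l x = ∑ l ∈ s, l f :=
      (Finset.sum_le_sum hle).antisymm (by simpa using hx f (hFC hf))
    have heq : ∀ l ∈ s, l x = l f := (Finset.sum_eq_sum_iff_of_le hle).1 hsum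
    have hm : m ∈ Submodule.span ℝ (s : Set (StrongDual ℝ E)) :=
      hs ▸ Submodule.subset_span (show m ∈ K from hFG)
    have hmx : m x = m f := by
      clear hG hFG
      induction hm using Submodule.span_induction with
      | mem l hl => exact heq l hl
      | zero => simp
      | add a b _ _ ha hb => simp_all
      | smul c a _ ha => simp_all
    exact ⟨hxC, fun y hy => hmx ▸ (hFG hf).2 y hy⟩

theorem stmt1 {n : ℕ} (C F : Set (EuclideanSpace ℝ (Fin n)))
    (hCc : IsCompact C) (hC : Convex ℝ C)
    (hF : IsExtreme ℝ C F) (hFconv : Convex ℝ F) (hFne : F.Nonempty) :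
    ∃ Fe : Set (EuclideanSpace ℝ (Fin n)), Fe ⊆ C ∧ IsExposed ℝ C Fe ∧ F ⊆ Fe ∧
      ∀ G : Set (EuclideanSpace ℝ (Fin n)), IsExposed ℝ C G → F ⊆ G → Fe ⊆ G := by
  obtain ⟨Fe, hFe, hFFe, hmin⟩ := exists_least_isExposed_superset hF.subset hFne
  exact ⟨Fe, hFe.subset, hFe, hFFe, hmin⟩
end

section
/- Let E be a real normed vector space, let C₀ be a nonempty compact convex subset of E, let x be a point of E not in C₀, and let C be the convex hull of C₀ ∪ {x}. Then a continuous linear functional f : E →L[ℝ] ℝ exposes x in C (that is, f(z) < f(x) for every z ∈ C with z ≠ x) if and only if f separates C₀ and {x} (that is, there exist real numbers s < t with f(y) < s for all y ∈ C₀ and t < f(x)). -/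
theorem stmt3 {E : Type*} [NormedAddCommGroup E] [NormedSpace ℝ E]
    (C₀ : Set E) (hne : C₀.Nonempty) (hcomp : IsCompact C₀) (hconv : Convex ℝ C₀)
    (x : E) (hx : x ∉ C₀)
    (C : Set E) (hC : C = convexHull ℝ (C₀ ∪ {x}))
    (f : E →L[ℝ] ℝ) :
    (∀ z ∈ C, z ≠ x → f z < f x) ↔
      ∃ s t : ℝ, s < t ∧ (∀ y ∈ C₀, f y < s) ∧ t < f x := by
  subst hC
  constructor
  · intro h
    obtain ⟨y₀, hy₀, hmax⟩ := hcomp.exists_isMaxOn hne f.continuous.continuousOn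
    have hlt : f y₀ < f x :=
      h y₀ (subset_convexHull ℝ _ (Or.inl hy₀)) (ne_of_mem_of_not_mem hy₀ hx)
    obtain ⟨s, hs, hsx⟩ := exists_between hlt
    obtain ⟨t, hst, htx⟩ := exists_between hsx
    exact ⟨s, t, hst, fun y hy => (hmax hy).trans_lt hs, htx⟩
  · rintro ⟨s, t, hst, hs, ht⟩ z hz hzx
    rw [hconv.convexHull_union (convex_singleton x) hne (Set.singleton_nonempty x),
      mem_convexJoin] at hz
    obtain ⟨y, hy, _, rfl, a, b, ha, -, hab, rfl⟩ := hz
    have ha0 : a ≠ 0 := by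
      rintro rfl
      obtain rfl : b = 1 := by simpa using hab
      simp at hzx
    have hyx : f y < f _ := ((hs y hy).trans hst).trans ht
    obtain rfl : b = 1 - a := by linarith
    simp only [map_add, map_smul, smul_eq_mul]
    linarith [mul_lt_mul_of_pos_left hyx (ha.lt_of_ne' ha0)]
end

section
/- Let E be a real normed vector space, let C be a compact convex subset of E, and let x be an isolated extreme point of C, i.e., x ∈ extremePoints ℝ C and there is ε > 0 such that every y ∈ extremePoints ℝ C with ‖y − x‖ < ε equals x. Then the set {f : E →L[ℝ] ℝ | f(z) < f(x) for every z ∈ C with z ≠ x} of continuous linear functionals that expose x in C is nonempty and open (in the operator-norm topology on E →L[ℝ] ℝ). -/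
/-- The convex join of two compact sets is compact. -/
protected theorem IsCompact.convexJoin {E : Type*} [AddCommGroup E] [Module ℝ E]
    [TopologicalSpace E] [ContinuousAdd E] [ContinuousSMul ℝ E] {s t : Set E}
    (hs : IsCompact s) (ht : IsCompact t) :
    IsCompact (convexJoin ℝ s t) := by
  have h : convexJoin ℝ s t =
      (fun p : ℝ × E × E => (1 - p.1) • p.2.1 + p.1 • p.2.2) '' (Set.Icc 0 1 ×ˢ s ×ˢ t) := by
    ext z
    simp only [mem_convexJoin, segment_eq_image, Set.mem_image, Set.mem_prod, Prod.exists]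
    constructor
    · rintro ⟨a, ha, b, hb, θ, hθ, rfl⟩
      exact ⟨θ, a, b, ⟨hθ, ha, hb⟩, rfl⟩
    · rintro ⟨θ, a, b, ⟨hθ, ha, hb⟩, rfl⟩
      exact ⟨a, ha, b, hb, θ, hθ, rfl⟩
  rw [h]
  exact (isCompact_Icc.prod (hs.prod ht)).image (by fun_prop)

/-- An extreme point of a set lies on no convex join of two subsets avoiding it. -/
theorem notMem_convexJoin_of_mem_extremePoints {E : Type*} [AddCommGroup E] [Module ℝ E]
    {C s t : Set E} {x : E} (hx : x ∈ Set.extremePoints ℝ C) (hs : s ⊆ C) (ht : t ⊆ C)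
    (hxs : x ∉ s) (hxt : x ∉ t) : x ∉ convexJoin ℝ s t := by
  rw [mem_convexJoin]
  rintro ⟨a, ha, b, hb, hab⟩
  rcases (mem_extremePoints_iff_forall_segment.1 hx).2 a (hs ha) b (ht hb) hab with rfl | rfl
  exacts [hxs ha, hxt hb]

/-- A compact subset of a compact convex set `C` that avoids an extreme point `x` of `C` lies in
a compact convex subset of `C` that avoids `x`. -/
theorem exists_isCompact_convex_superset_notMem {E : Type*} [NormedAddCommGroup E]
    [NormedSpace ℝ E] {C s : Set E} {x : E} (hcomp : IsCompact C) (hconv : Convex ℝ C)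
    (hx : x ∈ Set.extremePoints ℝ C) (hs : IsCompact s) (hsC : s ⊆ C) (hxs : x ∉ s) :
    ∃ K, IsCompact K ∧ Convex ℝ K ∧ K ⊆ C ∧ x ∉ K ∧ s ⊆ K := by
  refine hs.induction_on (p := fun s => ∃ K, IsCompact K ∧ Convex ℝ K ∧ K ⊆ C ∧ x ∉ K ∧ s ⊆ K)
    ⟨∅, isCompact_empty, convex_empty, by simp, by simp, subset_rfl⟩ ?_ ?_ ?_
  · rintro s t hst ⟨K, h₁, h₂, h₃, h₄, h₅⟩
    exact ⟨K, h₁, h₂, h₃, h₄, hst.trans h₅⟩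
  · rintro s t ⟨K, hK, hKc, hKC, hxK, hsK⟩ ⟨L, hL, hLc, hLC, hxL, htL⟩
    rcases K.eq_empty_or_nonempty with rfl | hKn
    · exact ⟨L, hL, hLc, hLC, hxL, Set.union_subset (hsK.trans (Set.empty_subset _)) htL⟩
    rcases L.eq_empty_or_nonempty with rfl | hLn
    · exact ⟨K, hK, hKc, hKC, hxK, Set.union_subset hsK (htL.trans (Set.empty_subset _))⟩
    exact ⟨convexJoin ℝ K L, hK.convexJoin hL, hKc.convexJoin hLc,
      convexJoin_subset hKC hLC hconv, notMem_convexJoin_of_mem_extremePoints hx hKC hLC hxK hxL,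
      Set.union_subset (hsK.trans (subset_convexJoin_left hLn))
        (htL.trans (subset_convexJoin_right hKn))⟩
  · intro y hy
    obtain ⟨f, hf⟩ := geometric_hahn_banach_point_point (E := E) (x := x) (y := y)
      (by rintro rfl; exact hxs hy)
    obtain ⟨r, hxr, hry⟩ := exists_between hf
    refine ⟨C ∩ {z | r ≤ f z}, ?_, C ∩ {z | r ≤ f z}, ?_, ?_, Set.inter_subset_left, ?_, subset_rfl⟩
    · refine Filter.inter_mem (Filter.mem_of_superset self_mem_nhdsWithin hsC)
        (mem_nhdsWithin_of_mem_nhds ?_)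
      filter_upwards [f.continuous.continuousAt.eventually_const_lt hry] with z hz using hz.le
    · exact hcomp.inter_right (isClosed_le continuous_const f.continuous)
    · exact hconv.inter (convex_halfSpace_ge f.toLinearMap.isLinear r)
    · exact fun h => hxr.not_ge h.2

/-- A compact convex set with an isolated extreme point `x` is a cone with apex `x` over a compact
convex set that avoids `x`. -/
theorem exists_base_of_isolated_extremePoint {E : Type*} [NormedAddCommGroup E]
    [NormedSpace ℝ E] {C : Set E} {x : E} (hcomp : IsCompact C) (hconv : Convex ℝ C)
    (hx : x ∈ Set.extremePoints ℝ C)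
    (hiso : ∃ ε > 0, ∀ y ∈ Set.extremePoints ℝ C, ‖y - x‖ < ε → y = x) :
    ∃ K, IsCompact K ∧ Convex ℝ K ∧ K ⊆ C ∧ x ∉ K ∧
      ∀ z ∈ C, z ≠ x → ∃ k ∈ K, ∃ b : ℝ, 0 < b ∧ z = x + b • (k - x) := by
  obtain ⟨ε, hε, hiso⟩ := hiso
  obtain ⟨K, hK, hKc, hKC, hxK, hCK⟩ := exists_isCompact_convex_superset_notMem hcomp hconv hx
    (hcomp.diff (Metric.isOpen_ball (x := x) (ε := ε))) Set.sdiff_subset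
    (fun h => h.2 (Metric.mem_ball_self hε))
  refine ⟨K, hK, hKc, hKC, hxK, fun z hz hzx => ?_⟩
  have hext : Set.extremePoints ℝ C ⊆ insert x K := fun y hy => by
    by_cases h : y ∈ Metric.ball x ε
    · exact Or.inl (hiso y hy (mem_ball_iff_norm.1 h))
    · exact Or.inr (hCK ⟨hy.1, h⟩)
  rw [← closure_convexHull_extremePoints hcomp hconv] at hz
  rcases K.eq_empty_or_nonempty with rfl | hKn
  · have : closure (convexHull ℝ (Set.extremePoints ℝ C)) ⊆ {x} :=
      closure_minimal (convexHull_min (hext.trans (by simp)) (convex_singleton x))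
        isClosed_singleton
    exact (hzx (this hz)).elim
  have hsub : closure (convexHull ℝ (Set.extremePoints ℝ C)) ⊆ convexJoin ℝ {x} K :=
    closure_minimal (convexHull_min (hext.trans (Set.insert_subset
      (subset_convexJoin_left hKn rfl) (subset_convexJoin_right (Set.singleton_nonempty x))))
      ((convex_singleton x).convexJoin hKc)) (isCompact_singleton.convexJoin hK).isClosed
  obtain ⟨_, rfl, k, hk, hzk⟩ := mem_convexJoin.1 (hsub hz)
  rw [segment_eq_image'] at hzk
  obtain ⟨b, hb, rfl⟩ := hzk
  refine ⟨k, hk, b, hb.1.lt_of_ne ?_, rfl⟩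
  rintro rfl
  simp at hzx

theorem stmt4 {E : Type*} [NormedAddCommGroup E] [NormedSpace ℝ E]
    (C : Set E) (hcomp : IsCompact C) (hconv : Convex ℝ C)
    (x : E) (hx : x ∈ Set.extremePoints ℝ C)
    (hiso : ∃ ε > 0, ∀ y ∈ Set.extremePoints ℝ C, ‖y - x‖ < ε → y = x) :
    ({f : E →L[ℝ] ℝ | ∀ z ∈ C, z ≠ x → f z < f x}).Nonempty ∧
      IsOpen {f : E →L[ℝ] ℝ | ∀ z ∈ C, z ≠ x → f z < f x} := by
  obtain ⟨K, hK, hKc, hKC, hxK, hcone⟩ :=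
    exists_base_of_isolated_extremePoint hcomp hconv hx hiso
  have heq : {f : E →L[ℝ] ℝ | ∀ z ∈ C, z ≠ x → f z < f x} = {f | ∀ k ∈ K, f k < f x} := by
    ext f
    refine ⟨fun h k hk => h k (hKC hk) (ne_of_mem_of_not_mem hk hxK), fun h z hz hzx => ?_⟩
    obtain ⟨k, hk, b, hb, rfl⟩ := hcone z hz hzx
    have := mul_pos hb (sub_pos.2 (h k hk))
    simp only [map_add, map_smul, map_sub, smul_eq_mul]
    linarith
  rw [heq]
  constructor
  · obtain ⟨f, r, hfK, hfx⟩ := geometric_hahn_banach_closed_point hKc hK.isClosed hxK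
    exact ⟨f, fun k hk => (hfK k hk).trans hfx⟩
  · refine isOpen_iff_eventually.2 fun f hf =>
      hK.eventually_forall_of_forall_eventually fun k hk => ?_
    have hc : Continuous fun p : (E →L[ℝ] ℝ) × E => p.1 p.2 := by fun_prop
    have hc' : Continuous fun p : (E →L[ℝ] ℝ) × E => p.1 x := by fun_prop
    exact (isOpen_lt hc hc').mem_nhds (hf k hk)
end

section
/- Let C be a compact convex subset of ℝⁿ and let x be an isolated extreme point of C, i.e., x ∈ extremePoints ℝ C and there is ε > 0 such that every y ∈ extremePoints ℝ C with ‖y − x‖ < ε equals x. Then there exist linearly independent vectors t₁, …, t_n ∈ ℝⁿ and real numbers α₁, …, α_n such that for each i, P(tᵢ,αᵢ) is a hyperplane of support for C (⟨tᵢ,y⟩ ≥ αᵢ for all y ∈ C) and {y ∈ C : ⟨tᵢ,y⟩ = αᵢ} = {x}. -/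
open RealInnerProductSpace

/-- In a finite-dimensional space, the convex hull of a compact set is compact. -/
theorem isCompact_convexHull_of_isCompact {E : Type*} [NormedAddCommGroup E] [NormedSpace ℝ E]
    [FiniteDimensional ℝ E] {s : Set E} (hs : IsCompact s) : IsCompact (convexHull ℝ s) := by
  have hunion : convexHull ℝ s = ⋃ k ∈ Finset.range (Module.finrank ℝ E + 2),
      (fun p : (Fin k → ℝ) × (Fin k → E) ↦ ∑ i, p.1 i • p.2 i) ''
        (stdSimplex ℝ (Fin k) ×ˢ Set.univ.pi fun _ ↦ s) := by
    ext y
    simp only [Set.mem_iUnion, Finset.mem_range]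
    constructor
    · intro hy
      obtain ⟨ι, _, z, w, hz, hind, hw, hw1, rfl⟩ := eq_pos_convex_span_of_mem_convexHull hy
      let e := Fintype.equivFin ι
      have hcard := hind.card_le_finrank_succ
      have hle := Submodule.finrank_le (vectorSpan ℝ (Set.range z))
      refine ⟨Fintype.card ι, by omega, (w ∘ e.symm, z ∘ e.symm), ⟨⟨fun i ↦ (hw _).le, ?_⟩, ?_⟩, ?_⟩
      · exact (Equiv.sum_comp e.symm w).trans hw1
      · exact fun i _ ↦ hz ⟨_, rfl⟩
      · exact Equiv.sum_comp e.symm fun i ↦ w i • z i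
    · rintro ⟨k, -, ⟨w, z⟩, ⟨⟨hw, hw1⟩, hz⟩, rfl⟩
      exact (convex_convexHull ℝ s).sum_mem (fun i _ ↦ hw i) hw1
        fun i _ ↦ subset_convexHull ℝ s (hz i trivial)
  rw [hunion]
  refine Finset.isCompact_biUnion _ fun k _ ↦ ?_
  exact ((isCompact_stdSimplex ℝ (Fin k)).prod (isCompact_univ_pi fun _ ↦ hs)).image (by fun_prop)

/-- A nonempty open set in a finite-dimensional space contains a linearly independent family
indexed by the dimension. -/
theorem IsOpen.exists_linearIndependent_fin {E : Type*} [NormedAddCommGroup E] [NormedSpace ℝ E]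
    [FiniteDimensional ℝ E] {U : Set E} (hU : IsOpen U) (hne : U.Nonempty) {n : ℕ}
    (hn : Module.finrank ℝ E = n) :
    ∃ t : Fin n → E, LinearIndependent ℝ t ∧ ∀ i, t i ∈ U := by
  obtain ⟨b, hbU, hspan, hb⟩ := exists_linearIndependent ℝ U
  have htop : Submodule.span ℝ U = ⊤ := Submodule.eq_top_of_nonempty_interior' _
    (hne.mono (interior_maximal Submodule.subset_span hU))
  let B := Module.Basis.mk hb (by rw [Subtype.range_coe, hspan, htop])
  have : Fintype b := FiniteDimensional.fintypeBasisIndex B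
  let e : Fin n ≃ b :=
    (finCongr (by rw [← hn, Module.finrank_eq_card_basis B])).trans (Fintype.equivFin b).symm
  exact ⟨fun i ↦ e i, hb.comp e e.injective, fun i ↦ hbU (e i).2⟩

/-- Linear functionals strictly larger on a compact set than at a point form an open set. -/
theorem isOpen_setOf_forall_inner_lt {E : Type*} [NormedAddCommGroup E] [InnerProductSpace ℝ E]
    {A : Set E} (hA : IsCompact A) (x : E) : IsOpen {t : E | ∀ a ∈ A, ⟪t, x⟫ < ⟪t, a⟫} := by
  refine isOpen_iff_mem_nhds.2 fun t ht ↦ hA.eventually_forall_of_forall_eventually fun a ha ↦ ?_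
  exact (isOpen_lt (by fun_prop) (by fun_prop) :
    IsOpen {p : E × E | ⟪p.1, x⟫ < ⟪p.1, p.2⟫}).mem_nhds (ht a ha)

/-- A functional strictly larger on `A` than at `x` is strictly larger than at `x` on the rest of
the convex hull of `insert x A`. -/
theorem eq_or_inner_lt_of_mem_convexHull_insert {E : Type*} [NormedAddCommGroup E]
    [InnerProductSpace ℝ E] {A : Set E} {t x y : E} (ht : ∀ a ∈ A, ⟪t, x⟫ < ⟪t, a⟫)
    (hy : y ∈ convexHull ℝ (insert x A)) : y = x ∨ ⟪t, x⟫ < ⟪t, y⟫ := by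
  refine convexHull_min (t := {y | y = x ∨ ⟪t, x⟫ < ⟪t, y⟫}) ?_ ?_ hy
  · rintro a (rfl | ha)
    exacts [Or.inl rfl, Or.inr (ht a ha)]
  · rw [convex_iff_forall_pos]
    intro u hu v hv a b ha hb hab
    have hx : ⟪t, x⟫ = a * ⟪t, x⟫ + b * ⟪t, x⟫ := by rw [← add_mul, hab, one_mul]
    rcases hu with rfl | hu <;> rcases hv with rfl | hv
    · exact Or.inl (Convex.combo_self hab _)
    all_goals
      right
      rw [inner_add_right, inner_smul_right, inner_smul_right]
      nlinarith

theorem stmt5 {n : ℕ} (C : Set (EuclideanSpace ℝ (Fin n)))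
    (hcomp : IsCompact C) (hconv : Convex ℝ C)
    (x : EuclideanSpace ℝ (Fin n)) (hx : x ∈ Set.extremePoints ℝ C)
    (hiso : ∃ ε > 0, ∀ y ∈ Set.extremePoints ℝ C, ‖y - x‖ < ε → y = x) :
    ∃ (t : Fin n → EuclideanSpace ℝ (Fin n)) (α : Fin n → ℝ),
      LinearIndependent ℝ t ∧
      ∀ i, (∀ y ∈ C, α i ≤ ⟪t i, y⟫) ∧ {y ∈ C | ⟪t i, y⟫ = α i} = {x} := by
  obtain ⟨ε, hε, hiso⟩ := hiso
  set A := closure (Set.extremePoints ℝ C \ {x})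
  have hAC : A ⊆ C :=
    closure_minimal (Set.sdiff_subset.trans extremePoints_subset) hcomp.isClosed
  have hA : IsCompact A := hcomp.of_isClosed_subset isClosed_closure hAC
  have hxA : x ∉ A := fun h ↦ by
    obtain ⟨y, ⟨hy, hyx⟩, hd⟩ := Metric.mem_closure_iff.1 h ε hε
    exact hyx (hiso y hy (by rwa [← dist_eq_norm, dist_comm]))
  have hxhull : x ∉ convexHull ℝ A := fun h ↦ hxA <| extremePoints_convexHull_subset <|
    inter_extremePoints_subset_extremePoints_of_subset (convexHull_min hAC hconv) ⟨h, hx⟩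
  have hCsub : C ⊆ convexHull ℝ (insert x A) := by
    rw [← closure_convexHull_extremePoints hcomp hconv]
    refine closure_minimal (convexHull_mono fun y hy ↦ ?_)
      (isCompact_convexHull_of_isCompact (hA.insert x)).isClosed
    by_cases h : y = x
    exacts [Or.inl h, Or.inr (subset_closure ⟨hy, h⟩)]
  have hne : {t : EuclideanSpace ℝ (Fin n) | ∀ a ∈ A, ⟪t, x⟫ < ⟪t, a⟫}.Nonempty := by
    obtain ⟨f, u, hfx, hf⟩ := geometric_hahn_banach_point_closed (convex_convexHull ℝ A)
      (isCompact_convexHull_of_isCompact hA).isClosed hxhull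
    refine ⟨(InnerProductSpace.toDual ℝ _).symm f, fun a ha ↦ ?_⟩
    simpa using hfx.trans (hf a (subset_convexHull ℝ A ha))
  obtain ⟨t, hlin, ht⟩ := (isOpen_setOf_forall_inner_lt hA x).exists_linearIndependent_fin hne
    finrank_euclideanSpace_fin
  refine ⟨t, fun i ↦ ⟪t i, x⟫, hlin, fun i ↦ ?_⟩
  have key (y) (hy : y ∈ C) := eq_or_inner_lt_of_mem_convexHull_insert (ht i) (hCsub hy)
  refine ⟨fun y hy ↦ ?_, Set.Subset.antisymm (fun y hy ↦ ?_) ?_⟩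
  · rcases key y hy with rfl | h
    exacts [le_rfl, h.le]
  · exact (key y hy.1).resolve_right hy.2.not_gt
  · rintro _ rfl
    exact ⟨hx.1, rfl⟩
end

section
/- Let C be a convex subset of ℝⁿ and let F be a nonempty face of C. Define the normal cone K_F = {t ∈ ℝⁿ : there exists α ∈ ℝ with ⟨t,y⟩ ≥ α for all y ∈ C and ⟨t,x⟩ = α for all x ∈ F}. Then deg(F) + dim(F) ≤ n, where deg(F) is the dimension of the real linear span of K_F (Lean: Module.finrank ℝ (Submodule.span ℝ K_F)) and dim(F) is the dimension of the affine span of F (Lean: Module.finrank ℝ (affineSpan ℝ F).direction). -/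
open RealInnerProductSpace

theorem stmt7 {n : ℕ} (C F : Set (EuclideanSpace ℝ (Fin n))) (hC : Convex ℝ C)
    (hF : IsExtreme ℝ C F) (hFne : F.Nonempty) :
    Module.finrank ℝ (Submodule.span ℝ
        {t : EuclideanSpace ℝ (Fin n) |
          ∃ α : ℝ, (∀ y ∈ C, α ≤ ⟪t, y⟫) ∧ ∀ x ∈ F, ⟪t, x⟫ = α}) +
      Module.finrank ℝ (affineSpan ℝ F).direction ≤ n := by
  have hperp : Submodule.span ℝ
      {t : EuclideanSpace ℝ (Fin n) |
        ∃ α : ℝ, (∀ y ∈ C, α ≤ ⟪t, y⟫) ∧ ∀ x ∈ F, ⟪t, x⟫ = α} ⟂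
      (affineSpan ℝ F).direction := by
    rw [direction_affineSpan, vectorSpan_def, Submodule.isOrtho_span]
    rintro t ⟨α, -, hα⟩ _ ⟨x, hx, y, hy, rfl⟩
    simp [vsub_eq_sub, inner_sub_right, hα x hx, hα y hy]
  simpa using Submodule.finrank_add_finrank_le_of_disjoint hperp.disjoint
end

section
/- Let A be a nontrivial unital C⋆-algebra, let τ : A →ₗ[ℂ] ℂ be a faithful positive tracial state (τ 1 = 1, τ(xy) = τ(yx) for all x, y, and for every a ≥ 0: (τ a).im = 0, 0 ≤ (τ a).re, and τ a = 0 implies a = 0), let b₁, …, b_n ∈ A be self-adjoint, define Ψ : A → ℝ^{n+1} by Ψ(a) = (Re τ(a), Re τ(b₁a), …, Re τ(b_na)), and let B = Ψ({a : 0 ≤ a ≤ 1}). For 0 ≤ k < n: if the linear span of B has dimension k+1 (Lean: Module.finrank ℝ (Submodule.span ℝ B) = k+1), then there exist real numbers s₁, …, s_{n−k} and linearly independent vectors t₁, …, t_{n−k} ∈ ℝⁿ such that b_{tᵢ} = sᵢ•1 for i = 1, …, n−k. Conversely, if such s₁, …, s_{n−k} and linearly independent t₁, …, t_{n−k} exist,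 then the linear span of B has dimension at most k+1. -/
/-- A self-adjoint element that a faithful positive functional cannot detect against the order
interval `[0, 1]` vanishes. -/
theorem eq_zero_of_forall_re_apply_mul_eq_zero {A : Type*} [CStarAlgebra A] [PartialOrder A]
    [StarOrderedRing A] (τ : A →ₗ[ℂ] ℂ)
    (hτpos : ∀ a : A, 0 ≤ a → (τ a).im = 0)
    (hτfaithful : ∀ a : A, 0 ≤ a → τ a = 0 → a = 0)
    {c : A} (hc : IsSelfAdjoint c)
    (h : ∀ a : A, 0 ≤ a → a ≤ 1 → (τ (c * a)).re = 0) : c = 0 := by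
  have hpos : ∀ a : A, 0 ≤ a → (τ (c * a)).re = 0 := by
    intro a ha
    have hr : 0 < ‖a‖ + 1 := by positivity
    have h0 : 0 ≤ (‖a‖ + 1)⁻¹ • a := smul_nonneg (by positivity) ha
    have h1 : (‖a‖ + 1)⁻¹ • a ≤ 1 := by
      rw [← CStarAlgebra.norm_le_one_iff_of_nonneg _ h0, norm_smul, norm_inv,
        Real.norm_of_nonneg hr.le, inv_mul_le_one₀ hr]
      linarith
    have h2 := h _ h0 h1
    rw [← Complex.coe_smul, mul_smul_comm, map_smul, smul_eq_mul, Complex.re_ofReal_mul] at h2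
    exact (mul_eq_zero.mp h2).resolve_left (inv_ne_zero hr.ne')
  have hcc : (τ (c * c)).re = 0 := by
    have := CFC.posPart_sub_negPart c hc
    calc (τ (c * c)).re = (τ (c * (c⁺ - c⁻))).re := by rw [this]
      _ = 0 := by
        rw [mul_sub, map_sub, Complex.sub_re, hpos _ (CFC.posPart_nonneg c),
          hpos _ (CFC.negPart_nonneg c), sub_zero]
  have hsq : 0 ≤ c * c := hc.mul_self_nonneg
  have hzero := hτfaithful _ hsq (Complex.ext hcc (hτpos _ hsq))
  rwa [← CStarRing.star_mul_self_eq_zero_iff, hc.star_eq]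

/-- The real-linear map sending `v` to `v₀ • 1 + ∑ⱼ vⱼ₊₁ • bⱼ`. -/
noncomputable def affineCombination {A : Type*} [CStarAlgebra A] {n : ℕ} (b : Fin n → A) :
    EuclideanSpace ℝ (Fin (n + 1)) →ₗ[ℝ] A where
  toFun v := (v 0 : ℂ) • (1 : A) + ∑ j, (v (Fin.succ j) : ℂ) • b j
  map_add' v w := by
    simp only [PiLp.add_apply, Complex.ofReal_add, add_smul, Finset.sum_add_distrib]
    abel
  map_smul' r v := by
    simp [mul_smul, Finset.smul_sum]

theorem affineCombination_apply {A : Type*} [CStarAlgebra A] {n : ℕ} (b : Fin n → A)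
    (v : EuclideanSpace ℝ (Fin (n + 1))) :
    affineCombination b v = (v 0 : ℂ) • (1 : A) + ∑ j, (v (Fin.succ j) : ℂ) • b j :=
  rfl

theorem isSelfAdjoint_affineCombination {A : Type*} [CStarAlgebra A] {n : ℕ} {b : Fin n → A}
    (hb : ∀ i, IsSelfAdjoint (b i)) (v : EuclideanSpace ℝ (Fin (n + 1))) :
    IsSelfAdjoint (affineCombination b v) := by
  simp [IsSelfAdjoint, affineCombination_apply, (hb _).star_eq]

/-- Dropping the zeroth coordinate. -/
def euclideanTail (n : ℕ) :
    EuclideanSpace ℝ (Fin (n + 1)) →ₗ[ℝ] EuclideanSpace ℝ (Fin n) where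
  toFun v := WithLp.toLp 2 fun j => v (Fin.succ j)
  map_add' _ _ := rfl
  map_smul' _ _ := rfl

theorem euclideanTail_apply {n : ℕ} (v : EuclideanSpace ℝ (Fin (n + 1))) (j : Fin n) :
    euclideanTail n v j = v (Fin.succ j) :=
  rfl

theorem disjoint_ker_affineCombination_ker_euclideanTail {A : Type*} [CStarAlgebra A]
    [Nontrivial A] {n : ℕ} (b : Fin n → A) :
    Disjoint (LinearMap.ker (affineCombination b)) (LinearMap.ker (euclideanTail n)) := by
  rw [Submodule.disjoint_def]
  intro v hv ht
  have hs : ∀ j : Fin n, v (Fin.succ j) = 0 := fun j => by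
    rw [← euclideanTail_apply, LinearMap.mem_ker.mp ht, PiLp.zero_apply]
  have h0 : v 0 = 0 := by
    simpa [affineCombination_apply, hs] using LinearMap.mem_ker.mp hv
  ext i
  refine Fin.cases ?_ (fun j => ?_) i
  · simpa using h0
  · simpa using hs j


theorem stmt9 {A : Type*} [CStarAlgebra A] [Nontrivial A] [PartialOrder A]
    [StarOrderedRing A] {n k : ℕ} (hk : k < n)
    (τ : A →ₗ[ℂ] ℂ) (hτ1 : τ 1 = 1)
    (hτtr : ∀ x y : A, τ (x * y) = τ (y * x))
    (hτpos : ∀ a : A, 0 ≤ a → (τ a).im = 0 ∧ 0 ≤ (τ a).re)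
    (hτfaithful : ∀ a : A, 0 ≤ a → τ a = 0 → a = 0)
    (b : Fin n → A) (hb : ∀ i, IsSelfAdjoint (b i))
    (Ψ : A → EuclideanSpace ℝ (Fin (n + 1)))
    (hΨ : ∀ a : A, Ψ a = (WithLp.equiv 2 (Fin (n + 1) → ℝ)).symm
      (Fin.cons ((τ a).re) (fun j => (τ (b j * a)).re)))
    (B : Set (EuclideanSpace ℝ (Fin (n + 1))))
    (hB : B = Ψ '' {a : A | 0 ≤ a ∧ a ≤ 1}) :
    (Module.finrank ℝ (Submodule.span ℝ B) = k + 1 →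
      ∃ (s : Fin (n - k) → ℝ) (t : Fin (n - k) → EuclideanSpace ℝ (Fin n)),
        LinearIndependent ℝ t ∧
        ∀ i, (∑ j, (t i j : ℂ) • b j) = (s i : ℂ) • (1 : A)) ∧
    (∀ (s : Fin (n - k) → ℝ) (t : Fin (n - k) → EuclideanSpace ℝ (Fin n)),
      LinearIndependent ℝ t →
      (∀ i, (∑ j, (t i j : ℂ) • b j) = (s i : ℂ) • (1 : A)) →
      Module.finrank ℝ (Submodule.span ℝ B) ≤ k + 1) := by
  have hinner : ∀ a v, inner ℝ (Ψ a) v = (τ (affineCombination b v * a)).re := by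
    intro a v
    simp [hΨ, PiLp.inner_apply, Fin.sum_univ_succ, affineCombination_apply, add_mul,
      Finset.sum_mul]
  have hker : (Submodule.span ℝ B)ᗮ = LinearMap.ker (affineCombination b) := by
    ext v
    rw [LinearMap.mem_ker, Submodule.mem_orthogonal]
    constructor
    · intro h
      refine eq_zero_of_forall_re_apply_mul_eq_zero τ (fun a ha => (hτpos a ha).1) hτfaithful
        (isSelfAdjoint_affineCombination hb v) fun a h0 h1 => ?_
      rw [← hinner]
      exact h _ (Submodule.subset_span (hB ▸ ⟨a, ⟨h0, h1⟩, rfl⟩))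
    · intro h u hu
      induction hu using Submodule.span_induction with
      | mem x hx =>
        rw [hB] at hx
        obtain ⟨a, -, rfl⟩ := hx
        simp [hinner, h]
      | zero => simp
      | add x y _ _ hx hy => rw [inner_add_left, hx, hy, add_zero]
      | smul r x _ hx => rw [inner_smul_left, hx, mul_zero]
  have hdim := (Submodule.span ℝ B).finrank_add_finrank_orthogonal
  rw [hker, finrank_euclideanSpace_fin] at hdim
  constructor
  · intro hfin
    let e := Module.finBasisOfFinrankEq ℝ (LinearMap.ker (affineCombination b))
      (n := n - k) (by omega)
    refine ⟨fun i => -(e i : EuclideanSpace ℝ (Fin (n + 1))) 0,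
      fun i => euclideanTail n (e i), ?_, fun i => ?_⟩
    · refine (e.linearIndependent.map' _ (Submodule.ker_subtype _)).map (f := euclideanTail n) ?_
      refine (disjoint_ker_affineCombination_ker_euclideanTail b).mono_left ?_
      rw [Submodule.span_le]
      rintro _ ⟨i, rfl⟩
      exact (e i).2
    · have h := LinearMap.mem_ker.mp (e i).2
      rw [affineCombination_apply, add_comm] at h
      simpa [euclideanTail_apply] using eq_neg_of_add_eq_zero_left h
  · intro s t ht hst
    let w : Fin (n - k) → EuclideanSpace ℝ (Fin (n + 1)) := fun i =>
      WithLp.toLp 2 (Fin.cons (-s i) (t i))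
    have hw : ∀ i, w i ∈ LinearMap.ker (affineCombination b) := fun i => by
      have hi := hst i
      simp only [Complex.coe_smul] at hi
      simp [affineCombination_apply, w, hi]
    have hwli : LinearIndependent ℝ w := LinearIndependent.of_comp (euclideanTail n) ht
    have hcard := (LinearIndependent.of_comp (v := fun i => (⟨w i, hw i⟩ :
      LinearMap.ker (affineCombination b))) (Submodule.subtype _) hwli).fintype_card_le_finrank
    rw [Fintype.card_fin] at hcard
    omega
end

section
/- Let C be a compact convex subset of ℝⁿ and let L : ℝⁿ →ₗ[ℝ] ℝᵐ be a linear map. If the set of extreme points of C is countable, then the set of extreme points of the image L(C) is countable. -/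
theorem stmt10 {n m : ℕ} (C : Set (EuclideanSpace ℝ (Fin n)))
    (hcomp : IsCompact C) (hconv : Convex ℝ C)
    (L : EuclideanSpace ℝ (Fin n) →ₗ[ℝ] EuclideanSpace ℝ (Fin m))
    (h : (Set.extremePoints ℝ C).Countable) :
    (Set.extremePoints ℝ (L '' C)).Countable := by
  exact (h.image L).mono <|
    surjOn_extremePoints_image L.toContinuousLinearMap.toContinuousAffineMap hcomp
end
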